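/- arXiv:2412.03391 — 6 statements merged into one kernel-verified Lean document; each statement's English description precedes it below -/
import Mathlib

section
/- (Proposition 1) For every class k : Fin K, the EDL variance term is strictly smaller than the EDL error term for that class: (α k / α₀) · (1 − α k / α₀) / (α₀ + 1) < (y k − α k / α₀)², where y is the one-hot encoding of the true class j. -/
/-- The variance `p (1 - p) / (S + 1)` of a Beta marginal with mean `p` and total concentration `S`
is less than `p ^ 2` as soon as the concentration `p S` is at least `1`. -/
lemma beta_variance_lt_sq_mean {p S : ℝ} (hS : 0 < S) (hp : 0 < p) (h : 1 ≤ p * S) :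
    p * (1 - p) / (S + 1) < p ^ 2 := by
  rw [div_lt_iff₀ (by positivity), sq, mul_assoc]
  gcongr
  linarith

/-- Proposition 1 (EDL): for every class `k`, the variance term of the EDL loss
is strictly smaller than the error term, provided all Dirichlet parameters are `≥ 1`. -/
theorem edl_var_lt_err (K : ℕ) (hK : 2 ≤ K) (α : Fin K → ℝ) (hα : ∀ k, 1 ≤ α k)
    (j : Fin K) (y : Fin K → ℝ) (hyj : y j = 1) (hy : ∀ k, k ≠ j → y k = 0)
    (α₀ : ℝ) (hα₀ : α₀ = ∑ k, α k) (k : Fin K) :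
    (α k / α₀) * (1 - α k / α₀) / (α₀ + 1) < (y k - α k / α₀) ^ 2 := by
  have : Nontrivial (Fin K) := Fin.nontrivial_iff_two_le.2 hK
  obtain ⟨l, hl⟩ := exists_ne k
  have hsum : α k + α l ≤ α₀ := by
    rw [hα₀, ← Finset.sum_pair hl.symm]
    exact Finset.sum_le_sum_of_subset_of_nonneg (Finset.subset_univ _)
      fun i _ _ => zero_le_one.trans (hα i)
  have hk := hα k
  have hl₁ := hα l
  have hpos : 0 < α₀ := by linarith
  have hmul : α k / α₀ * α₀ = α k := div_mul_cancel₀ _ hpos.ne'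
  by_cases hkj : k = j
  · have hlt : α k / α₀ < 1 := (div_lt_one hpos).2 (by linarith)
    have := beta_variance_lt_sq_mean (p := 1 - α k / α₀) hpos (by linarith) (by linarith)
    rw [sub_sub_cancel, mul_comm (1 - _)] at this
    rwa [hkj, hyj, ← hkj]
  · rw [hy k hkj, zero_sub, neg_sq]
    exact beta_variance_lt_sq_mean hpos (by positivity) (by linarith)
end

section
/- (Proposition 2) The EDL error term strictly decreases when new evidence is added to the true-class Dirichlet parameter and strictly increases when evidence is removed from it: for every ε > 0 one has L^err(α + ε·e_j) < L^err(α), and for every ε with 0 < ε ≤ α j − 1 one has L^err(α − ε·e_j) > L^err(α); here e_j is the j-th standard basis vector (only coordinate j of α is changed, and the normalizer α₀ changes accordingly). -/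
/-- The EDL error term `L^err(α) = ∑ₖ (yₖ - αₖ/α₀)²` where `α₀ = ∑ₘ αₘ`. -/
noncomputable def Lerr {K : ℕ} (y α : Fin K → ℝ) : ℝ :=
  ∑ k, (y k - α k / ∑ m, α m) ^ 2

/-- With a one-hot label at `j`, the error term is `C / α₀²`, where `C` depends only on the
off-label parameters. -/
theorem Lerr_eq_div_sq {K : ℕ} {y α : Fin K → ℝ} {j : Fin K} (hyj : y j = 1)
    (hy : ∀ k, k ≠ j → y k = 0) (hα : ∑ m, α m ≠ 0) :
    Lerr y α = ((∑ k ∈ Finset.univ.erase j, α k) ^ 2 + ∑ k ∈ Finset.univ.erase j, α k ^ 2) /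
      (∑ m, α m) ^ 2 := by
  have hsum := Finset.add_sum_erase Finset.univ α (Finset.mem_univ j)
  have hoff : ∑ k ∈ Finset.univ.erase j, (y k - α k / ∑ m, α m) ^ 2 =
      (∑ k ∈ Finset.univ.erase j, α k ^ 2) / (∑ m, α m) ^ 2 := by
    rw [Finset.sum_div]
    refine Finset.sum_congr rfl fun k hk => ?_
    rw [hy k (Finset.ne_of_mem_erase hk), zero_sub, neg_sq, div_pow]
  rw [Lerr, ← Finset.add_sum_erase _ _ (Finset.mem_univ j), hoff, hyj, add_div, ← div_pow,
    one_sub_div hα, ← hsum, add_sub_cancel_left]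

/-- The error term is strictly antitone in the parameter of the labelled class. -/
theorem Lerr_lt_Lerr_of_lt {K : ℕ} {y α β : Fin K → ℝ} {j : Fin K} (hyj : y j = 1)
    (hy : ∀ k, k ≠ j → y k = 0) (hαj : 0 ≤ α j) (hpos : 0 < ∑ k ∈ Finset.univ.erase j, α k)
    (hβ : ∀ k, k ≠ j → β k = α k) (hlt : α j < β j) :
    Lerr y β < Lerr y α := by
  have hα₀ := Finset.add_sum_erase Finset.univ α (Finset.mem_univ j)
  have hβ₀ := Finset.add_sum_erase Finset.univ β (Finset.mem_univ j)
  have hsum : ∑ k ∈ Finset.univ.erase j, β k = ∑ k ∈ Finset.univ.erase j, α k :=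
    Finset.sum_congr rfl fun k hk => hβ k (Finset.ne_of_mem_erase hk)
  have hsq : ∑ k ∈ Finset.univ.erase j, β k ^ 2 = ∑ k ∈ Finset.univ.erase j, α k ^ 2 :=
    Finset.sum_congr rfl fun k hk => by rw [hβ k (Finset.ne_of_mem_erase hk)]
  have hα_pos : 0 < ∑ m, α m := by linarith
  have hαβ : ∑ m, α m < ∑ m, β m := by linarith
  rw [Lerr_eq_div_sq hyj hy hα_pos.ne', Lerr_eq_div_sq hyj hy (hα_pos.trans hαβ).ne', hsum, hsq]
  have hnum : 0 < (∑ k ∈ Finset.univ.erase j, α k) ^ 2 + ∑ k ∈ Finset.univ.erase j, α k ^ 2 :=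
    add_pos_of_pos_of_nonneg (pow_pos hpos 2) (Finset.sum_nonneg fun k _ => sq_nonneg _)
  gcongr

/-- Proposition 2 (EDL): the error term strictly decreases when evidence is added
to the true-class parameter `α j`, and strictly increases when evidence
(up to `α j - 1`) is removed from it. -/
theorem edl_err_monotone_in_true_class (K : ℕ) (hK : 2 ≤ K)
    (α : Fin K → ℝ) (hα : ∀ k, 1 ≤ α k)
    (j : Fin K) (y : Fin K → ℝ) (hyj : y j = 1) (hy : ∀ k, k ≠ j → y k = 0) :
    (∀ ε : ℝ, 0 < ε →
      Lerr y (fun k => α k + ε * (if k = j then 1 else 0)) < Lerr y α) ∧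
    (∀ ε : ℝ, 0 < ε → ε ≤ α j - 1 →
      Lerr y α < Lerr y (fun k => α k - ε * (if k = j then 1 else 0))) := by
  have hpos : 0 < ∑ k ∈ Finset.univ.erase j, α k := by
    refine Finset.sum_pos (fun k _ => by linarith [hα k]) (Finset.card_pos.mp ?_)
    rw [Finset.card_erase_of_mem (Finset.mem_univ j), Finset.card_univ, Fintype.card_fin]
    omega
  constructor
  · intro ε hε
    refine Lerr_lt_Lerr_of_lt hyj hy (by linarith [hα j]) hpos (fun k hk => ?_) ?_
    · simp [hk]
    · simpa using hε
  · intro ε hε hεj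
    refine Lerr_lt_Lerr_of_lt hyj hy ?_ ?_ (fun k hk => ?_) ?_
    · simp only [if_true]
      linarith
    · refine hpos.trans_eq (Finset.sum_congr rfl fun k hk => ?_)
      simp [Finset.ne_of_mem_erase hk]
    · simp [hk]
    · simpa using hε
end

section
/- (Proposition 2, functional form) Fix the non-true-class parameters α k ≥ 1 for k ≠ j, and for t > 0 let β(t) : Fin K → ℝ be the vector with β(t) j = t and β(t) k = α k for k ≠ j. Then the function t ↦ ∑_k (y k − β(t) k / (∑_m β(t) m))² is strictly decreasing on (0, ∞). -/
/-- Against the one-hot encoding of `j`, the error term is an inverse square in the total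
parameter mass `t + ∑ k ∈ univ.erase j, α k`. -/
theorem sum_sq_sub_div_eq_of_oneHot {ι : Type*} [Fintype ι] [DecidableEq ι] (j : ι) (y : ι → ℝ)
    (hyj : y j = 1) (hy : ∀ k, k ≠ j → y k = 0) (α : ι → ℝ) (t : ℝ)
    (h : t + ∑ k ∈ Finset.univ.erase j, α k ≠ 0) :
    ∑ k, (y k - (if k = j then t else α k) / ∑ m, (if m = j then t else α m)) ^ 2 =
      ((∑ k ∈ Finset.univ.erase j, α k) ^ 2 + ∑ k ∈ Finset.univ.erase j, α k ^ 2) /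
        (t + ∑ k ∈ Finset.univ.erase j, α k) ^ 2 := by
  have total : ∑ m, (if m = j then t else α m) = t + ∑ k ∈ Finset.univ.erase j, α k := by
    rw [← Finset.add_sum_erase _ _ (Finset.mem_univ j), if_pos rfl]
    congr 1
    exact Finset.sum_congr rfl fun k hk => if_neg (Finset.ne_of_mem_erase hk)
  rw [total, ← Finset.add_sum_erase _ _ (Finset.mem_univ j), if_pos rfl, hyj, add_div,
    Finset.sum_div]
  congr 1
  · field_simp
    ring
  · refine Finset.sum_congr rfl fun k hk => ?_
    have hkj := Finset.ne_of_mem_erase hk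
    rw [if_neg hkj, hy k hkj, zero_sub, neg_sq, div_pow]

/-- Proposition 2, functional form: with the non-true-class Dirichlet parameters
`α k ≥ 1` (for `k ≠ j`) fixed, the EDL error term, as a function of the
true-class parameter `t`, is strictly decreasing on `(0, ∞)`. -/
theorem edl_err_strictAntiOn_true_class (K : ℕ) (hK : 2 ≤ K)
    (j : Fin K) (y : Fin K → ℝ) (hyj : y j = 1) (hy : ∀ k, k ≠ j → y k = 0)
    (α : Fin K → ℝ) (hα : ∀ k, k ≠ j → 1 ≤ α k) :
    StrictAntiOn
      (fun t : ℝ =>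
        ∑ k, (y k - (if k = j then t else α k) / ∑ m, (if m = j then t else α m)) ^ 2)
      (Set.Ioi 0) := by
  have hne : (Finset.univ.erase j).Nonempty := by
    rw [← Finset.card_pos, Finset.card_erase_of_mem (Finset.mem_univ j), Finset.card_univ,
      Fintype.card_fin]
    omega
  have hpos : 0 < ∑ k ∈ Finset.univ.erase j, α k :=
    Finset.sum_pos (fun k hk => one_pos.trans_le (hα k (Finset.ne_of_mem_erase hk))) hne
  intro s hs t ht hst
  rw [Set.mem_Ioi] at hs ht
  dsimp only
  rw [sum_sq_sub_div_eq_of_oneHot j y hyj hy α s (by positivity),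
    sum_sq_sub_div_eq_of_oneHot j y hyj hy α t (by positivity)]
  gcongr
end

section
/- (Proposition 3) Let l : Fin K with l ≠ j be a class whose Dirichlet parameter is largest among the non-true classes, i.e. α l ≥ α k for all k ≠ j. Then removing evidence from α l strictly decreases the EDL error term: for every ε > 0 such that α l − ε ≥ 1 and α l − ε ≥ α k for all k with k ≠ j and k ≠ l, one has L^err(α − ε·e_l) < L^err(α), where e_l is the l-th standard basis vector (only coordinate l of α is changed, and the normalizer α₀ changes accordingly). -/
theorem Finset.sum_univ_eq_add_add_sum_erase_erase {ι M : Type*} [Fintype ι] [DecidableEq ι]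
    [AddCommMonoid M] {j l : ι} (hlj : l ≠ j) (f : ι → M) :
    ∑ k, f k = f j + (f l + ∑ k ∈ (Finset.univ.erase j).erase l, f k) := by
  rw [Finset.add_sum_erase _ f (Finset.mem_erase.mpr ⟨hlj, Finset.mem_univ l⟩),
    Finset.add_sum_erase _ f (Finset.mem_univ j)]

/-- The error term of a one-hot label at `j`, with the class `l ≠ j` singled out. -/
theorem Lerr_eq_div {K : ℕ} {y : Fin K → ℝ} {j l : Fin K} (hlj : l ≠ j) (hyj : y j = 1)
    (hy : ∀ k, k ≠ j → y k = 0) (α : Fin K → ℝ) {r q : ℝ}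
    (hr : ∑ k ∈ (Finset.univ.erase j).erase l, α k = r)
    (hq : ∑ k ∈ (Finset.univ.erase j).erase l, α k ^ 2 = q)
    (hS : α j + (α l + r) ≠ 0) :
    Lerr y α = ((α l + r) ^ 2 + (α l ^ 2 + q)) / (α j + (α l + r)) ^ 2 := by
  have hsum : ∑ m, α m = α j + (α l + r) := by
    rw [Finset.sum_univ_eq_add_add_sum_erase_erase hlj, hr]
  have hrest : ∑ k ∈ (Finset.univ.erase j).erase l, (y k - α k / (α j + (α l + r))) ^ 2
      = q / (α j + (α l + r)) ^ 2 := by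
    rw [← hq, Finset.sum_div]
    refine Finset.sum_congr rfl fun k hk => ?_
    rw [hy k (Finset.ne_of_mem_erase (Finset.mem_of_mem_erase hk)), zero_sub, neg_sq, div_pow]
  rw [Lerr, hsum, Finset.sum_univ_eq_add_add_sum_erase_erase hlj, hrest, hyj, hy l hlj]
  field_simp
  ring

/-- Increasing the dominant coordinate `c` by `ε` strictly increases the error term. -/
theorem sq_add_sq_div_sq_lt {a c r q ε : ℝ} (ha : 0 < a) (hc : 0 < c) (hr : 0 ≤ r)
    (hq : q ≤ c * r) (hε : 0 < ε) :
    ((c + r) ^ 2 + (c ^ 2 + q)) / (a + (c + r)) ^ 2 <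
      ((c + ε + r) ^ 2 + ((c + ε) ^ 2 + q)) / (a + (c + ε + r)) ^ 2 := by
  obtain ⟨T, hT⟩ : ∃ T, T = a + (c + r) := ⟨_, rfl⟩
  have hT' : a + (c + ε + r) = T + ε := by rw [hT]; ring
  have hT0 : 0 < T := by rw [hT]; positivity
  have hlin : (c + r) * (T + ε) < (c + ε + r) * T := by
    rw [hT]; nlinarith [mul_pos ha hε]
  have hfst : (c + r) ^ 2 * (T + ε) ^ 2 < (c + ε + r) ^ 2 * T ^ 2 := by
    rw [← mul_pow, ← mul_pow]
    exact pow_lt_pow_left₀ hlin (by positivity) two_ne_zero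
  have hcq : c ^ 2 + q ≤ c * T := by
    rw [hT]; nlinarith [mul_pos ha hc]
  have hcT : c ≤ T := by linarith
  have hsnd : (c ^ 2 + q) * (T + ε) ^ 2 ≤ ((c + ε) ^ 2 + q) * T ^ 2 := by
    have h₁ : (c ^ 2 + q) * (ε * (2 * T + ε)) ≤ c * T * (ε * (2 * T + ε)) := by gcongr
    have h₂ : c * (T * ε ^ 2) ≤ T * (T * ε ^ 2) := by gcongr
    linarith
  rw [← hT, hT', div_lt_div_iff₀ (by positivity) (by positivity)]
  linarith

/-- Proposition 3 (EDL): removing evidence `ε` from a largest non-true-class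
Dirichlet parameter `α l` strictly decreases the EDL error term, provided the
result stays `≥ 1` and stays at least as large as every other non-true-class
parameter. -/
theorem edl_err_decreases_removing_from_largest (K : ℕ) (hK : 2 ≤ K)
    (α : Fin K → ℝ) (hα : ∀ k, 1 ≤ α k)
    (j : Fin K) (y : Fin K → ℝ) (hyj : y j = 1) (hy : ∀ k, k ≠ j → y k = 0)
    (l : Fin K) (hlj : l ≠ j) (hl : ∀ k, k ≠ j → α k ≤ α l)
    (ε : ℝ) (hε : 0 < ε) (hε1 : 1 ≤ α l - ε)
    (hεmax : ∀ k, k ≠ j → k ≠ l → α k ≤ α l - ε) :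
    Lerr y (fun k => α k - ε * (if k = l then 1 else 0)) < Lerr y α := by
  obtain ⟨r, hr⟩ : ∃ r, ∑ k ∈ (Finset.univ.erase j).erase l, α k = r := ⟨_, rfl⟩
  obtain ⟨q, hq⟩ : ∃ q, ∑ k ∈ (Finset.univ.erase j).erase l, α k ^ 2 = q := ⟨_, rfl⟩
  have hpos : ∀ k, 0 < α k := fun k => one_pos.trans_le (hα k)
  have hr0 : 0 ≤ r := hr ▸ Finset.sum_nonneg fun k _ => (hpos k).le
  have hqr : q ≤ (α l - ε) * r := by
    rw [← hq, ← hr, Finset.mul_sum]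
    refine Finset.sum_le_sum fun k hk => ?_
    rw [sq]
    exact mul_le_mul_of_nonneg_right (hεmax k
      (Finset.ne_of_mem_erase (Finset.mem_of_mem_erase hk)) (Finset.ne_of_mem_erase hk))
      (hpos k).le
  have hc : 0 < α l - ε := one_pos.trans_le hε1
  have hj := hpos j
  have hβ : ∀ k ∈ (Finset.univ.erase j).erase l,
      α k - ε * (if k = l then 1 else 0) = α k := fun k hk => by
    simp [Finset.ne_of_mem_erase hk]
  have hold := Lerr_eq_div hlj hyj hy α hr hq (by linarith [hpos l])
  have hnew := Lerr_eq_div hlj hyj hy (fun k => α k - ε * (if k = l then 1 else 0))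
    ((Finset.sum_congr rfl hβ).trans hr)
    ((Finset.sum_congr rfl fun k hk => by rw [hβ k hk]).trans hq)
    (by simp only [if_true, if_neg hlj.symm, mul_one, mul_zero, sub_zero]; linarith)
  simp only [if_true, if_neg hlj.symm, mul_one, mul_zero, sub_zero] at hnew
  rw [hold, hnew]
  simpa only [sub_add_cancel] using sq_add_sq_div_sq_lt hj hc hr0 hqr hε
end

section
/- (Dirichlet normalization / multivariate Beta integral) ∫_T ∏_k (π(x) k)^(α k − 1) dx = (∏_k Γ(α k)) / Γ(α₀); equivalently, the Dirichlet density integrates to one: ∫_T dirα(x) dx = 1. -/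
open MeasureTheory

/-- The open parameter domain of the probability simplex over `K` outcomes:
vectors of the first `K-1` coordinates, all positive, summing to less than 1. -/
def simplexT (K : ℕ) : Set (Fin (K - 1) → ℝ) :=
  {x | (∀ i, 0 < x i) ∧ ∑ i, x i < 1}

/-- The point of the probability simplex over `K` outcomes determined by its
first `K-1` coordinates: `π(x) i = x i` for `i < K-1` and
`π(x) (K-1) = 1 - ∑ᵢ x i`. -/
noncomputable def simplexCoord (K : ℕ) (x : Fin (K - 1) → ℝ) (i : Fin K) : ℝ :=
  if h : (i : ℕ) < K - 1 then x ⟨i, h⟩ else 1 - ∑ m, x m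

/-- The Dirichlet density with parameter `α`, in the simplex parametrization. -/
noncomputable def dirDensity (K : ℕ) (α : Fin K → ℝ) (x : Fin (K - 1) → ℝ) : ℝ :=
  (Real.Gamma (∑ k, α k) / ∏ k, Real.Gamma (α k)) *
    ∏ k, simplexCoord K x k ^ (α k - 1)

/-- The Beta integral over `(0, t)`. -/
lemma integral_Ioo_rpow_mul_sub_rpow {a b t : ℝ} (ha : 0 < a) (hb : 0 < b) (ht : 0 < t) :
    ∫ x in Set.Ioo 0 t, x ^ (a - 1) * (t - x) ^ (b - 1) =
      t ^ (a + b - 1) * (Real.Gamma a * Real.Gamma b / Real.Gamma (a + b)) := by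
  have h := Complex.betaIntegral_scaled (a : ℂ) (b : ℂ) ht
  rw [Complex.betaIntegral_eq_Gamma_mul_div _ _ (by simpa) (by simpa), ← Complex.ofReal_add,
    Complex.Gamma_ofReal, Complex.Gamma_ofReal, Complex.Gamma_ofReal,
    intervalIntegral.integral_of_le ht.le, integral_Ioc_eq_integral_Ioo] at h
  rw [← Complex.ofReal_inj, ← integral_complex_ofReal]
  push_cast [Complex.ofReal_cpow ht.le] at h ⊢
  rw [← h]
  refine setIntegral_congr_fun measurableSet_Ioo fun x hx => ?_
  simp only [Complex.ofReal_cpow hx.1.le, Complex.ofReal_cpow (sub_nonneg.2 hx.2.le)]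
  push_cast
  rfl

lemma lintegral_Ioo_rpow_mul_sub_rpow {a b t : ℝ} (ha : 0 < a) (hb : 0 < b) (ht : 0 < t) :
    ∫⁻ x in Set.Ioo 0 t, ENNReal.ofReal (x ^ (a - 1) * (t - x) ^ (b - 1)) =
      ENNReal.ofReal (t ^ (a + b - 1) * (Real.Gamma a * Real.Gamma b / Real.Gamma (a + b))) := by
  have hpos : 0 < t ^ (a + b - 1) * (Real.Gamma a * Real.Gamma b / Real.Gamma (a + b)) := by
    have := Real.Gamma_pos_of_pos ha
    have := Real.Gamma_pos_of_pos hb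
    have := Real.Gamma_pos_of_pos (add_pos ha hb)
    positivity
  rw [← integral_Ioo_rpow_mul_sub_rpow ha hb ht] at hpos ⊢
  refine (ofReal_integral_eq_lintegral_ofReal ?_ ?_).symm
  · exact not_imp_comm.1 integral_undef hpos.ne'
  · refine ae_restrict_of_forall_mem measurableSet_Ioo fun x hx => ?_
    exact mul_nonneg (Real.rpow_nonneg hx.1.le _) (Real.rpow_nonneg (sub_nonneg.2 hx.2.le) _)

/-- The open corner simplex of size `t` in `ℝⁿ`. -/
def cornerSimplex (n : ℕ) (t : ℝ) : Set (Fin n → ℝ) :=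
  {x | (∀ i, 0 < x i) ∧ ∑ i, x i < t}

lemma measurableSet_cornerSimplex (n : ℕ) (t : ℝ) : MeasurableSet (cornerSimplex n t) := by
  unfold cornerSimplex
  measurability

lemma cons_mem_cornerSimplex {n : ℕ} {t x : ℝ} {y : Fin n → ℝ} :
    (Fin.cons x y : Fin (n + 1) → ℝ) ∈ cornerSimplex (n + 1) t ↔
      x ∈ Set.Ioo 0 t ∧ y ∈ cornerSimplex n (t - x) := by
  simp only [cornerSimplex, Set.mem_ofPred_eq, Fin.forall_fin_succ, Fin.sum_univ_succ,
    Fin.cons_zero, Fin.cons_succ, Set.mem_Ioo]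
  constructor
  · rintro ⟨⟨hx, hy⟩, h⟩
    have := Finset.sum_nonneg fun i (_ : i ∈ Finset.univ) => (hy i).le
    exact ⟨⟨hx, by linarith⟩, hy, by linarith⟩
  · rintro ⟨⟨hx, -⟩, hy, h⟩
    exact ⟨⟨hx, hy⟩, by linarith⟩

/-- The Dirichlet integral over the corner simplex of size `t`. -/
lemma lintegral_cornerSimplex {n : ℕ} {a : Fin n → ℝ} {b t : ℝ} (ha : ∀ i, 0 < a i) (hb : 0 < b)
    (ht : 0 < t) :
    ∫⁻ x in cornerSimplex n t,
        ENNReal.ofReal ((∏ i, x i ^ (a i - 1)) * (t - ∑ i, x i) ^ (b - 1)) =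
      ENNReal.ofReal (t ^ (∑ i, a i + b - 1) *
        ((∏ i, Real.Gamma (a i)) * Real.Gamma b / Real.Gamma (∑ i, a i + b))) := by
  induction n generalizing t with
  | zero =>
    have : cornerSimplex 0 t = Set.univ := by ext; simp [cornerSimplex, ht]
    simp [this, (Real.Gamma_pos_of_pos hb).ne', volume_pi]
  | succ n ih =>
    have hA : 0 < ∑ i : Fin n, a i.succ + b :=
      add_pos_of_nonneg_of_pos (Finset.sum_nonneg fun i _ => (ha i.succ).le) hb
    have hG := Real.Gamma_pos_of_pos hA
    have hC : 0 ≤ (∏ i : Fin n, Real.Gamma (a i.succ)) * Real.Gamma b /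
        Real.Gamma (∑ i : Fin n, a i.succ + b) :=
      div_nonneg (mul_nonneg (Finset.prod_nonneg fun i _ => (Real.Gamma_pos_of_pos (ha _)).le)
        (Real.Gamma_pos_of_pos hb).le) hG.le
    rw [← lintegral_indicator (measurableSet_cornerSimplex _ _),
      ← (volume_preserving_piFinSuccAbove (fun _ => ℝ) 0).symm.lintegral_comp_emb
        (MeasurableEquiv.measurableEmbedding _), Measure.volume_eq_prod, lintegral_prod]
    · have key (x : ℝ) : ∫⁻ y : Fin n → ℝ, (cornerSimplex (n + 1) t).indicator
          (fun x => ENNReal.ofReal ((∏ i, x i ^ (a i - 1)) * (t - ∑ i, x i) ^ (b - 1)))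
          ((MeasurableEquiv.piFinSuccAbove (fun _ => ℝ) 0).symm (x, y)) =
          (Set.Ioo 0 t).indicator (fun x => ENNReal.ofReal
            (x ^ (a 0 - 1) * (t - x) ^ (∑ i : Fin n, a i.succ + b - 1)) *
            ENNReal.ofReal ((∏ i : Fin n, Real.Gamma (a i.succ)) * Real.Gamma b /
              Real.Gamma (∑ i : Fin n, a i.succ + b))) x := by
        have hcons (y : Fin n → ℝ) : (MeasurableEquiv.piFinSuccAbove (fun _ => ℝ) 0).symm (x, y) =
            (Fin.cons x y : Fin (n + 1) → ℝ) := by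
          simp [MeasurableEquiv.piFinSuccAbove, Fin.insertNthEquiv]
        simp only [hcons]
        by_cases hx : x ∈ Set.Ioo 0 t
        · rw [Set.indicator_of_mem hx, ← ENNReal.ofReal_mul' hC, mul_assoc,
            ENNReal.ofReal_mul (Real.rpow_nonneg hx.1.le _),
            ← ih (fun i => ha i.succ) (sub_pos.2 hx.2),
            ← lintegral_const_mul' _ _ ENNReal.ofReal_ne_top,
            ← lintegral_indicator (measurableSet_cornerSimplex _ _)]
          refine lintegral_congr fun y => ?_
          by_cases hy : y ∈ cornerSimplex n (t - x)
          · rw [Set.indicator_of_mem (cons_mem_cornerSimplex.2 ⟨hx, hy⟩), Set.indicator_of_mem hy,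
              ← ENNReal.ofReal_mul (Real.rpow_nonneg hx.1.le _)]
            simp only [Fin.prod_univ_succ, Fin.sum_univ_succ, Fin.cons_zero, Fin.cons_succ,
              mul_assoc, sub_sub]
          · rw [Set.indicator_of_notMem fun h => hy (cons_mem_cornerSimplex.1 h).2,
              Set.indicator_of_notMem hy]
        · rw [Set.indicator_of_notMem hx]
          simp only [Set.indicator_of_notMem fun h => hx (cons_mem_cornerSimplex.1 h).1,
            lintegral_zero]
      simp only [key]
      rw [lintegral_indicator measurableSet_Ioo, lintegral_mul_const' _ _ ENNReal.ofReal_ne_top,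
        lintegral_Ioo_rpow_mul_sub_rpow (ha 0) hA ht, ← ENNReal.ofReal_mul' hC,
        Fin.sum_univ_succ, Fin.prod_univ_succ, add_assoc (a 0)]
      congr 1
      field_simp
    · refine (Measurable.indicator ?_ (measurableSet_cornerSimplex _ _)).comp
        (MeasurableEquiv.measurable _) |>.aemeasurable
      fun_prop

lemma prod_simplexCoord_rpow {n : ℕ} (α : Fin (n + 1) → ℝ) (x : Fin n → ℝ) :
    ∏ k, simplexCoord (n + 1) x k ^ (α k - 1) =
      (∏ i : Fin n, x i ^ (α i.castSucc - 1)) * (1 - ∑ i, x i) ^ (α (Fin.last n) - 1) := by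
  simp [Fin.prod_univ_castSucc, simplexCoord]

lemma integral_prod_simplexCoord_rpow {n : ℕ} {α : Fin (n + 1) → ℝ} (hα : ∀ k, 0 < α k) :
    ∫ x in simplexT (n + 1), ∏ k, simplexCoord (n + 1) x k ^ (α k - 1) =
      (∏ k, Real.Gamma (α k)) / Real.Gamma (∑ k, α k) := by
  change ∫ x in cornerSimplex n 1, ∏ k, simplexCoord (n + 1) x k ^ (α k - 1) = _
  simp only [prod_simplexCoord_rpow]
  rw [integral_eq_lintegral_of_nonneg_ae, lintegral_cornerSimplex (fun i => hα i.castSucc)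
    (hα (Fin.last n)) one_pos, Real.one_rpow, one_mul, ← Fin.sum_univ_castSucc,
    ← Fin.prod_univ_castSucc (fun k => Real.Gamma (α k)), ENNReal.toReal_ofReal]
  · exact div_nonneg (Finset.prod_nonneg fun k _ => (Real.Gamma_pos_of_pos (hα k)).le)
      (Real.Gamma_nonneg_of_nonneg (Finset.sum_nonneg fun k _ => (hα k).le))
  · refine ae_restrict_of_forall_mem (measurableSet_cornerSimplex _ _) fun x hx => ?_
    exact mul_nonneg (Finset.prod_nonneg fun i _ => Real.rpow_nonneg (hx.1 i).le _)
      (Real.rpow_nonneg (sub_nonneg.2 hx.2.le) _)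
  · exact Measurable.aestronglyMeasurable (by fun_prop)

/-- Dirichlet normalization (multivariate Beta integral): the product
`∏ₖ πₖ^(αₖ-1)` integrates over the simplex to `(∏ₖ Γ(αₖ)) / Γ(α₀)`;
equivalently, the Dirichlet density integrates to `1`. -/
theorem dirichlet_normalization (K : ℕ) (hK : 2 ≤ K)
    (α : Fin K → ℝ) (hα : ∀ k, 0 < α k) :
    (∫ x in simplexT K, ∏ k, simplexCoord K x k ^ (α k - 1) =
      (∏ k, Real.Gamma (α k)) / Real.Gamma (∑ k, α k)) ∧
    (∫ x in simplexT K, dirDensity K α x = 1) := by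
  obtain ⟨n, rfl⟩ : ∃ n, K = n + 1 := ⟨K - 1, by omega⟩
  have h := integral_prod_simplexCoord_rpow hα
  refine ⟨h, ?_⟩
  have hs : 0 < ∑ k, α k := Finset.sum_pos (fun k _ => hα k) Finset.univ_nonempty
  have hp : 0 < ∏ k, Real.Gamma (α k) :=
    Finset.prod_pos fun k _ => Real.Gamma_pos_of_pos (hα k)
  simp only [dirDensity]
  rw [integral_const_mul, h, div_mul_div_cancel₀ hp.ne', div_self (Real.Gamma_pos_of_pos hs).ne']
end

section
/- (Equation (1), Dirichlet variance) For every class k : Fin K, the variance of the k-th coordinate under the Dirichlet density equals α k (α₀ − α k) / (α₀² (α₀ + 1)); that is, ∫_T (π(x) k)² · dirα(x) dx − (∫_T (π(x) k) · dirα(x) dx)² = α k (α₀ − α k) / (α₀² (α₀ + 1)). -/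
open MeasureTheory

lemma lintegral_rpow_mul_sub_rpow {a b s : ℝ} (ha : 0 < a) (hb : 0 < b) (hs : 0 < s) :
    ∫⁻ t in Set.Ioo 0 s, ENNReal.ofReal (t ^ (a - 1) * (s - t) ^ (b - 1)) =
      ENNReal.ofReal
        (s ^ (a + b - 1) * (Real.Gamma a * Real.Gamma b / Real.Gamma (a + b))) := by
  have hB : 0 < ProbabilityTheory.beta a b := ProbabilityTheory.beta_pos ha hb
  have unit_case : ∫⁻ t in Set.Ioo (0 : ℝ) 1, ENNReal.ofReal (t ^ (a - 1) * (1 - t) ^ (b - 1)) =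
      ENNReal.ofReal (ProbabilityTheory.beta a b) := by
    have h := ProbabilityTheory.lintegral_betaPDF_eq_one ha hb
    rw [ProbabilityTheory.lintegral_betaPDF] at h
    simp_rw [mul_assoc, ENNReal.ofReal_mul (one_div_pos.2 hB).le] at h
    rw [lintegral_const_mul' _ _ ENNReal.ofReal_ne_top] at h
    rw [ENNReal.eq_inv_of_mul_eq_one_left ((mul_comm _ _).trans h), one_div,
      ENNReal.ofReal_inv_of_pos hB, inv_inv]
  have himage : (fun t : ℝ => s * t) '' Set.Ioo 0 1 = Set.Ioo 0 s := by
    rw [Set.image_mul_left_Ioo hs, mul_zero, mul_one]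
  rw [← himage, lintegral_image_eq_lintegral_abs_deriv_mul measurableSet_Ioo
    (f' := fun _ => s) (fun x _ => by simpa using ((hasDerivAt_id x).const_mul s).hasDerivWithinAt)
    (fun x _ y _ h => mul_left_cancel₀ hs.ne' h)]
  have hscale : ∀ t ∈ Set.Ioo (0 : ℝ) 1,
      ENNReal.ofReal |s| * ENNReal.ofReal ((s * t) ^ (a - 1) * (s - s * t) ^ (b - 1)) =
      ENNReal.ofReal (s ^ (a + b - 1)) * ENNReal.ofReal (t ^ (a - 1) * (1 - t) ^ (b - 1)) := by
    intro t ht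
    rw [← ENNReal.ofReal_mul (abs_nonneg s), ← ENNReal.ofReal_mul (by positivity), abs_of_pos hs,
      show s - s * t = s * (1 - t) by ring, Real.mul_rpow hs.le ht.1.le,
      Real.mul_rpow hs.le (by linarith [ht.2]),
      show a + b - 1 = 1 + (a - 1) + (b - 1) by ring, Real.rpow_add hs, Real.rpow_add hs,
      Real.rpow_one]
    congr 1
    ring
  rw [setLIntegral_congr_fun measurableSet_Ioo hscale,
    lintegral_const_mul' _ _ ENNReal.ofReal_ne_top, unit_case,
    ← ENNReal.ofReal_mul (by positivity), ProbabilityTheory.beta]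

lemma measurableSet_pos_sum_lt (n : ℕ) (s : ℝ) :
    MeasurableSet {x : Fin n → ℝ | (∀ i, 0 < x i) ∧ ∑ i, x i < s} := by
  have hsum : Measurable fun x : Fin n → ℝ => ∑ i, x i := by fun_prop
  have hpos : MeasurableSet {x : Fin n → ℝ | ∀ i, 0 < x i} := by
    rw [Set.ofPred_forall]
    exact MeasurableSet.iInter fun i => measurableSet_lt measurable_const (measurable_pi_apply i)
  exact hpos.inter (measurableSet_lt hsum measurable_const)

/-- Dirichlet's integral over the open simplex of size `s`. -/
theorem lintegral_dirichlet (n : ℕ) {a : Fin n → ℝ} {b s : ℝ} (ha : ∀ i, 0 < a i) (hb : 0 < b)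
    (hs : 0 < s) :
    ∫⁻ x in {x : Fin n → ℝ | (∀ i, 0 < x i) ∧ ∑ i, x i < s},
        ENNReal.ofReal ((∏ i, x i ^ (a i - 1)) * (s - ∑ i, x i) ^ (b - 1)) =
      ENNReal.ofReal (s ^ (∑ i, a i + b - 1) *
        ((∏ i, Real.Gamma (a i)) * Real.Gamma b / Real.Gamma (∑ i, a i + b))) := by
  induction n generalizing s with
  | zero =>
    have hG : Real.Gamma b ≠ 0 := (Real.Gamma_pos_of_pos hb).ne'
    simp [hs, hG, volume_pi]
  | succ n ih =>
    set A := ∑ i : Fin n, a i.succ with hA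
    have hA0 : 0 ≤ A := Finset.sum_nonneg fun i _ => (ha _).le
    have hGb := Real.Gamma_pos_of_pos hb
    have hGA := Real.Gamma_pos_of_pos (show 0 < A + b by linarith)
    have hGa : 0 < ∏ i : Fin n, Real.Gamma (a i.succ) :=
      Finset.prod_pos fun i _ => Real.Gamma_pos_of_pos (ha _)
    set C := (∏ i : Fin n, Real.Gamma (a i.succ)) * Real.Gamma b / Real.Gamma (A + b) with hC
    have hCpos : 0 < C := by positivity
    rw [← lintegral_indicator (measurableSet_pos_sum_lt _ _)]
    have hmeas : Measurable ({x : Fin (n + 1) → ℝ | (∀ i, 0 < x i) ∧ ∑ i, x i < s}.indicator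
        fun x => ENNReal.ofReal ((∏ i, x i ^ (a i - 1)) * (s - ∑ i, x i) ^ (b - 1))) :=
      Measurable.indicator (by fun_prop) (measurableSet_pos_sum_lt _ _)
    have hmp := (volume_preserving_piFinSuccAbove (fun _ : Fin (n + 1) => ℝ) 0).symm
    rw [← hmp.lintegral_comp hmeas, Measure.volume_eq_prod,
      lintegral_prod _ (by exact (hmeas.comp hmp.measurable).aemeasurable)]
    have hfiber : ∀ t : ℝ,
        ∫⁻ y : Fin n → ℝ, {x : Fin (n + 1) → ℝ | (∀ i, 0 < x i) ∧ ∑ i, x i < s}.indicator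
          (fun x => ENNReal.ofReal ((∏ i, x i ^ (a i - 1)) * (s - ∑ i, x i) ^ (b - 1)))
          ((MeasurableEquiv.piFinSuccAbove (fun _ : Fin (n + 1) => ℝ) 0).symm (t, y)) =
        (Set.Ioo 0 s).indicator (fun t => ENNReal.ofReal C *
          ENNReal.ofReal (t ^ (a 0 - 1) * (s - t) ^ (A + b - 1))) t := by
      intro t
      by_cases ht : t ∈ Set.Ioo 0 s
      · have hts : 0 < s - t := sub_pos.2 ht.2
        have ht0 : 0 ≤ t ^ (a 0 - 1) := Real.rpow_nonneg ht.1.le _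
        rw [Set.indicator_of_mem ht, ← ENNReal.ofReal_mul hCpos.le,
          show C * (t ^ (a 0 - 1) * (s - t) ^ (A + b - 1)) =
            t ^ (a 0 - 1) * ((s - t) ^ (A + b - 1) * C) by ring,
          ENNReal.ofReal_mul ht0, hC, hA, ← ih (fun i => ha i.succ) hts,
          ← lintegral_const_mul' _ _ ENNReal.ofReal_ne_top,
          ← lintegral_indicator (measurableSet_pos_sum_lt _ _)]
        congr 1
        ext y
        simp only [Set.indicator, Set.mem_ofPred_eq, MeasurableEquiv.piFinSuccAbove_symm_apply,
          Fin.insertNthEquiv_apply, Fin.insertNth_zero', Fin.forall_fin_succ, Fin.sum_univ_succ,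
          Fin.prod_univ_succ, Fin.cons_zero, Fin.cons_succ, ht.1, true_and, lt_sub_iff_add_lt']
        rw [← ENNReal.ofReal_mul ht0, ← mul_assoc, ← sub_sub]
      · rw [Set.indicator_of_notMem ht]
        convert lintegral_zero with y
        refine Set.indicator_of_notMem (fun hx => ht ?_) _
        simp only [Set.mem_ofPred_eq, MeasurableEquiv.piFinSuccAbove_symm_apply,
          Fin.insertNthEquiv_apply, Fin.insertNth_zero', Fin.forall_fin_succ, Fin.sum_univ_succ,
          Fin.cons_zero, Fin.cons_succ] at hx
        have : 0 ≤ ∑ i, y i := Finset.sum_nonneg fun i _ => (hx.1.2 i).le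
        exact ⟨hx.1.1, by linarith [hx.2]⟩
    simp_rw [hfiber]
    rw [lintegral_indicator measurableSet_Ioo, lintegral_const_mul' _ _ ENNReal.ofReal_ne_top,
      lintegral_rpow_mul_sub_rpow (ha 0) (by linarith) hs, ← ENNReal.ofReal_mul hCpos.le,
      Fin.sum_univ_succ, Fin.prod_univ_succ, ← hA, ← add_assoc, hC]
    congr 1
    field_simp

lemma simplexCoord_castSucc (n : ℕ) (x : Fin n → ℝ) (i : Fin n) :
    simplexCoord (n + 1) x i.castSucc = x i := by
  simp [simplexCoord]

lemma simplexCoord_last (n : ℕ) (x : Fin n → ℝ) :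
    simplexCoord (n + 1) x (Fin.last n) = 1 - ∑ i, x i := by
  simp [simplexCoord]

lemma simplexCoord_pos {n : ℕ} {x : Fin n → ℝ} (hx : x ∈ simplexT (n + 1)) (i : Fin (n + 1)) :
    0 < simplexCoord (n + 1) x i := by
  induction i using Fin.lastCases with
  | last => rw [simplexCoord_last]; exact sub_pos.2 hx.2
  | cast i => rw [simplexCoord_castSucc]; exact hx.1 i

/-- Dirichlet's integral over the open probability simplex. -/
theorem setIntegral_prod_simplexCoord_rpow (n : ℕ) {α : Fin (n + 1) → ℝ} (hα : ∀ k, 0 < α k) :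
    ∫ x in simplexT (n + 1), ∏ k, simplexCoord (n + 1) x k ^ (α k - 1) =
      (∏ k, Real.Gamma (α k)) / Real.Gamma (∑ k, α k) := by
  have hT : MeasurableSet (simplexT (n + 1)) := measurableSet_pos_sum_lt n 1
  have hsum : 0 < ∑ k, α k := Finset.sum_pos (fun k _ => hα k) Finset.univ_nonempty
  have hprod : ∀ x : Fin n → ℝ, ∏ k, simplexCoord (n + 1) x k ^ (α k - 1) =
      (∏ i : Fin n, x i ^ (α i.castSucc - 1)) * (1 - ∑ i, x i) ^ (α (Fin.last n) - 1) := by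
    intro x
    simp only [Fin.prod_univ_castSucc, simplexCoord_castSucc, simplexCoord_last]
  rw [integral_eq_lintegral_of_nonneg_ae]
  · have h := lintegral_dirichlet n (fun i => hα i.castSucc) (hα (Fin.last n)) one_pos
    simp only [← hprod, Real.one_rpow, one_mul, ← Fin.sum_univ_castSucc α,
      ← Fin.prod_univ_castSucc fun k => Real.Gamma (α k)] at h
    refine (congrArg ENNReal.toReal h).trans (ENNReal.toReal_ofReal ?_)
    exact div_nonneg (Finset.prod_nonneg fun k _ => (Real.Gamma_pos_of_pos (hα k)).le)
      (Real.Gamma_pos_of_pos hsum).le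
  · filter_upwards [ae_restrict_mem hT] with x hx
    exact Finset.prod_nonneg fun k _ => Real.rpow_nonneg (simplexCoord_pos hx k).le _
  · refine Measurable.aestronglyMeasurable ?_
    change Measurable fun x : Fin n → ℝ => ∏ k, simplexCoord (n + 1) x k ^ (α k - 1)
    simp_rw [hprod]
    fun_prop

/-- The moments of the coordinates under the Dirichlet density. -/
theorem setIntegral_simplexCoord_pow_mul_dirDensity (n : ℕ) {α : Fin (n + 1) → ℝ}
    (hα : ∀ k, 0 < α k) (k : Fin (n + 1)) (c : ℕ) :
    ∫ x in simplexT (n + 1), simplexCoord (n + 1) x k ^ c * dirDensity (n + 1) α x =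
      Real.Gamma (∑ m, α m) * Real.Gamma (α k + c) /
        (Real.Gamma (α k) * Real.Gamma (∑ m, α m + c)) := by
  have hT : MeasurableSet (simplexT (n + 1)) := measurableSet_pos_sum_lt n 1
  set β : Fin (n + 1) → ℝ := fun m => α m + if m = k then (c : ℝ) else 0 with hβ
  have hβpos : ∀ m, 0 < β m := fun m => by
    have := hα m
    simp only [hβ]
    positivity
  have hcongr : ∀ x ∈ simplexT (n + 1),
      simplexCoord (n + 1) x k ^ c * dirDensity (n + 1) α x =
      (Real.Gamma (∑ m, α m) / ∏ m, Real.Gamma (α m)) *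
        ∏ m, simplexCoord (n + 1) x m ^ (β m - 1) := by
    intro x hx
    have hsplit : ∀ m, simplexCoord (n + 1) x m ^ (β m - 1) =
        simplexCoord (n + 1) x m ^ (α m - 1) *
          if m = k then simplexCoord (n + 1) x m ^ c else 1 := by
      intro m
      rw [hβ, add_sub_right_comm, Real.rpow_add (simplexCoord_pos hx m)]
      split_ifs <;> simp
    simp only [hsplit, Finset.prod_mul_distrib, Finset.prod_ite_eq', Finset.mem_univ, if_true,
      dirDensity]
    ring
  have hsum : ∑ m, β m = ∑ m, α m + c := by simp [hβ, Finset.sum_add_distrib]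
  have hGamma : (∏ m, Real.Gamma (β m)) * Real.Gamma (α k) =
      (∏ m, Real.Gamma (α m)) * Real.Gamma (α k + c) := by
    rw [← Finset.mul_prod_erase _ _ (Finset.mem_univ k),
      ← Finset.mul_prod_erase _ (fun m => Real.Gamma (α m)) (Finset.mem_univ k),
      Finset.prod_congr rfl fun m hm => show Real.Gamma (β m) = Real.Gamma (α m) by
        simp [hβ, Finset.ne_of_mem_erase hm]]
    simp only [hβ, if_true]
    ring
  have hk := (Real.Gamma_pos_of_pos (hα k)).ne'
  have hP : ∏ m, Real.Gamma (α m) ≠ 0 :=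
    Finset.prod_ne_zero_iff.2 fun m _ => (Real.Gamma_pos_of_pos (hα m)).ne'
  have hS : Real.Gamma (∑ m, α m + c) ≠ 0 := by
    rw [← hsum]
    exact (Real.Gamma_pos_of_pos
      (Finset.sum_pos (fun m _ => hβpos m) Finset.univ_nonempty)).ne'
  rw [setIntegral_congr_fun hT hcongr, integral_const_mul,
    setIntegral_prod_simplexCoord_rpow n hβpos, hsum]
  field_simp
  linear_combination Real.Gamma (∑ m, α m) * hGamma

/-- Dirichlet variance (Equation (1)): the variance of the `k`-th coordinate
under the Dirichlet density is `αₖ(α₀-αₖ) / (α₀²(α₀+1))`. -/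
theorem dirichlet_variance (K : ℕ) (hK : 2 ≤ K)
    (α : Fin K → ℝ) (hα : ∀ k, 0 < α k) (k : Fin K) :
    (∫ x in simplexT K, (simplexCoord K x k) ^ 2 * dirDensity K α x) -
      (∫ x in simplexT K, simplexCoord K x k * dirDensity K α x) ^ 2 =
      α k * ((∑ m, α m) - α k) / ((∑ m, α m) ^ 2 * ((∑ m, α m) + 1)) := by
  obtain ⟨n, rfl⟩ : ∃ n, K = n + 1 := ⟨K - 1, by omega⟩
  have hsum : 0 < ∑ m, α m := Finset.sum_pos (fun m _ => hα m) Finset.univ_nonempty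
  have hsum1 : 0 < ∑ m, α m + 1 := by linarith
  have hk := hα k
  have hk1 : 0 < α k + 1 := by linarith
  have hG := Real.Gamma_pos_of_pos hsum
  have hGk := Real.Gamma_pos_of_pos hk
  have h1 := setIntegral_simplexCoord_pow_mul_dirDensity n hα k 1
  have h2 := setIntegral_simplexCoord_pow_mul_dirDensity n hα k 2
  simp only [pow_one, Nat.cast_one] at h1
  rw [Nat.cast_ofNat, ← one_add_one_eq_two (R := ℝ), ← add_assoc, ← add_assoc,
    Real.Gamma_add_one hk1.ne', Real.Gamma_add_one hsum1.ne', Real.Gamma_add_one hk.ne',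
    Real.Gamma_add_one hsum.ne'] at h2
  rw [Real.Gamma_add_one hk.ne', Real.Gamma_add_one hsum.ne'] at h1
  rw [h1, h2]
  field_simp
  ring
end
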